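/- arXiv:2009.08964 — 2 statements merged into one kernel-verified Lean document; each statement's English description precedes it below -/
import Mathlib

section
/- If p > q > 0 are relatively prime integers, then U(p/q) + U(p/(p−q)) = V(p/q) − 1. -/
/-- Hirzebruch–Jung continued fraction `[x_1, …, x_k]⁻`,
defined recursively by `[x_k]⁻ = x_k` and `[x_1,…,x_k]⁻ = x_1 − 1/[x_2,…,x_k]⁻`. -/
noncomputable def hj : List ℝ → ℝ
  | [] => 0
  | [x] => x
  | x :: y :: l => x - 1 / hj (y :: l)

/-- The predicate asserting that the Hirzebruch–Jung continued fraction of a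
(nonempty) tuple is defined, i.e. no division by zero occurs in the recursion. -/
noncomputable def hjDef : List ℝ → Prop
  | [] => False
  | [_] => True
  | _ :: y :: l => hjDef (y :: l) ∧ hj (y :: l) ≠ 0

/-- `IsHJExp l p q` says that `l = (a_1, …, a_k)` is the Hirzebruch–Jung continued
fraction expansion of `p/q`: it is nonempty, all entries are integers `≥ 2`,
and `[a_1, …, a_k]⁻ = p/q`. -/
def IsHJExp (l : List ℤ) (p q : ℤ) : Prop :=
  l ≠ [] ∧ (∀ x ∈ l, 2 ≤ x) ∧ hj (l.map Int.cast) = (p : ℝ) / (q : ℝ)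

/-- `U([a_1,…,a_k]⁻) = Σ (a_i − 2)`. -/
def Ulist (l : List ℤ) : ℤ := (l.map (· - 2)).sum

/-- `V([a_1,…,a_k]⁻) = Σ (a_i − 1)`. -/
def Vlist (l : List ℤ) : ℤ := (l.map (· - 1)).sum

theorem hj_map_cons (x : ℤ) {l : List ℤ} (hl : l ≠ []) :
    hj ((x :: l).map Int.cast) = x - 1 / hj (l.map Int.cast) := by
  cases l with
  | nil => exact absurd rfl hl
  | cons y l => rfl

theorem hj_map_singleton (x : ℤ) : hj ([x].map Int.cast) = x := rfl

theorem hj_map_sub_one_cons (x : ℤ) (l : List ℤ) :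
    hj (((x - 1) :: l).map Int.cast) = hj ((x :: l).map Int.cast) - 1 := by
  by_cases hl : l = []
  · subst hl
    simp only [hj_map_singleton]
    push_cast
    ring
  · rw [hj_map_cons _ hl, hj_map_cons _ hl]
    push_cast
    ring

theorem one_lt_hj {l : List ℤ} (hl : l ≠ []) (h : ∀ x ∈ l, 2 ≤ x) :
    1 < hj (l.map Int.cast) := by
  induction l with
  | nil => exact absurd rfl hl
  | cons x l ih =>
    have hx : (2 : ℝ) ≤ x := by exact_mod_cast h x List.mem_cons_self
    by_cases hl' : l = []
    · subst hl'
      rw [hj_map_singleton]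
      linarith
    · have hlt := ih hl' fun y hy => h y (List.mem_cons_of_mem _ hy)
      rw [hj_map_cons _ hl']
      have := (div_lt_one (zero_lt_one.trans hlt)).2 hlt
      linarith

theorem sub_one_lt_hj_cons_lt {l : List ℤ} (x : ℤ) (hl : l ≠ []) (h : ∀ y ∈ l, 2 ≤ y) :
    (x : ℝ) - 1 < hj ((x :: l).map Int.cast) ∧ hj ((x :: l).map Int.cast) < x := by
  have hlt := one_lt_hj hl h
  have h0 := zero_lt_one.trans hlt
  rw [hj_map_cons _ hl]
  have h1 := (div_lt_one h0).2 hlt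
  have h2 := one_div_pos.2 h0
  constructor <;> linarith

/-- The entries of an expansion of `2` are forced. -/
theorem eq_singleton_two_of_hj_eq_two {l : List ℤ} (hl : l ≠ []) (h : ∀ x ∈ l, 2 ≤ x)
    (h2 : hj (l.map Int.cast) = 2) : l = [2] := by
  obtain ⟨x, l, rfl⟩ := List.exists_cons_of_ne_nil hl
  by_cases hl' : l = []
  · subst hl'
    rw [hj_map_singleton] at h2
    have : x = 2 := by exact_mod_cast h2
    rw [this]
  · obtain ⟨h3, h4⟩ :=
      sub_one_lt_hj_cons_lt x hl' fun y hy => h y (List.mem_cons_of_mem _ hy)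
    rw [h2] at h3 h4
    have h5 : x - 1 < 2 := by exact_mod_cast h3
    have h6 : 2 < x := by exact_mod_cast h4
    omega

theorem exists_eq_two_cons_of_hj_le_two {l : List ℤ} (hl : l ≠ []) (h : ∀ x ∈ l, 2 ≤ x)
    (h2 : hj (l.map Int.cast) ≤ 2) : ∃ t, l = 2 :: t := by
  obtain ⟨x, l, rfl⟩ := List.exists_cons_of_ne_nil hl
  have hx := h x List.mem_cons_self
  refine ⟨l, ?_⟩
  by_cases hl' : l = []
  · subst hl'
    rw [hj_map_singleton] at h2
    have : x ≤ 2 := by exact_mod_cast h2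
    rw [le_antisymm this hx]
  · have h3 := (sub_one_lt_hj_cons_lt x hl' fun y hy => h y (List.mem_cons_of_mem _ hy)).1
    have h5 : x - 1 < 2 := by exact_mod_cast h3.trans_le h2
    rw [show x = 2 by omega]

theorem three_le_of_two_lt_hj {x : ℤ} {l : List ℤ} (h : ∀ y ∈ l, 2 ≤ y)
    (h2 : 2 < hj ((x :: l).map Int.cast)) : 3 ≤ x := by
  by_cases hl' : l = []
  · subst hl'
    rw [hj_map_singleton] at h2
    have : 2 < x := by exact_mod_cast h2
    omega
  · have h3 := (sub_one_lt_hj_cons_lt x hl' h).2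
    have h5 : 2 < x := by exact_mod_cast h2.trans h3
    omega

@[simp]
theorem Ulist_cons (x : ℤ) (l : List ℤ) : Ulist (x :: l) = x - 2 + Ulist l := rfl

@[simp]
theorem Ulist_nil : Ulist [] = 0 := rfl

theorem Vlist_eq_Ulist_add_length (l : List ℤ) : Vlist l = Ulist l + l.length := by
  induction l with
  | nil => rfl
  | cons x l ih =>
    have : Vlist (x :: l) = x - 1 + Vlist l := rfl
    rw [this, ih, Ulist_cons, List.length_cons]
    push_cast
    ring

/-- Riemenschneider duality for lengths: if `1 / x + 1 / y = 1`, written as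
`(x - 1) * (y - 1) = 1`, then the expansions of `x` and `y` satisfy
`U y + 1 = len x` and `U x + 1 = len y`. -/
theorem Ulist_add_one_eq_length_of_dual (a b : List ℤ) (ha : a ≠ []) (hb : b ≠ [])
    (ha2 : ∀ x ∈ a, 2 ≤ x) (hb2 : ∀ x ∈ b, 2 ≤ x)
    (hab : (hj (a.map Int.cast) - 1) * (hj (b.map Int.cast) - 1) = 1) :
    Ulist b + 1 = a.length ∧ Ulist a + 1 = b.length := by
  induction hn : a.length + b.length using Nat.strong_induction_on generalizing a b with
  | _ n ih =>
  wlog hle : hj (a.map Int.cast) ≤ 2 generalizing a b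
  · have hle' : hj (b.map Int.cast) ≤ 2 := by
      have := one_lt_hj hb hb2
      nlinarith
    exact (this b a hb ha hb2 ha2 (by rw [mul_comm, hab]) (by omega) hle').symm
  obtain ⟨a, rfl⟩ := exists_eq_two_cons_of_hj_le_two ha ha2 hle
  by_cases ha' : a = []
  · subst ha'
    rw [hj_map_singleton] at hab
    have : b = [2] := eq_singleton_two_of_hj_eq_two hb hb2 (by push_cast at hab; linarith)
    subst this
    simp
  · have ha2' : ∀ x ∈ a, 2 ≤ x := fun x hx => ha2 x (List.mem_cons_of_mem _ hx)
    obtain ⟨y, b, rfl⟩ := List.exists_cons_of_ne_nil hb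
    have hb2' : ∀ x ∈ b, 2 ≤ x := fun x hx => hb2 x (List.mem_cons_of_mem _ hx)
    have hlt := one_lt_hj ha' ha2'
    have hblt := one_lt_hj hb hb2
    have hy : 3 ≤ y := by
      apply three_le_of_two_lt_hj hb2'
      have := (sub_one_lt_hj_cons_lt 2 ha' ha2').2
      push_cast at this
      nlinarith
    have key : (hj (a.map Int.cast) - 1) * (hj (((y - 1) :: b).map Int.cast) - 1) = 1 := by
      rw [hj_map_sub_one_cons]
      rw [hj_map_cons _ ha'] at hab
      have h0 : hj (a.map Int.cast) ≠ 0 := by positivity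
      field_simp at hab
      push_cast at hab
      linarith
    have := ih (a.length + ((y - 1) :: b).length) (by rw [← hn]; simp) a ((y - 1) :: b) ha'
      (by simp) ha2' (by
        intro x hx
        rcases List.mem_cons.1 hx with rfl | hx
        · omega
        · exact hb2' x hx) key rfl
    simp only [Ulist_cons, List.length_cons] at this ⊢
    push_cast at this ⊢
    omega

/-- If `p > q > 0` are relatively prime integers, then
`U(p/q) + U(p/(p−q)) = V(p/q) − 1`. -/
theorem stmt_9 (p q : ℤ) (hq : 0 < q) (hpq : q < p) (hco : IsCoprime p q)
    (a b : List ℤ) (ha : IsHJExp a p q) (hb : IsHJExp b p (p - q)) :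
    Ulist a + Ulist b = Vlist a - 1 := by
  obtain ⟨ha0, ha2, ha⟩ := ha
  obtain ⟨hb0, hb2, hb⟩ := hb
  have hq' : (q : ℝ) ≠ 0 := by exact_mod_cast hq.ne'
  have hpq' : (p : ℝ) - q ≠ 0 := by exact_mod_cast (sub_pos.2 hpq).ne'
  have hab : (hj (a.map Int.cast) - 1) * (hj (b.map Int.cast) - 1) = 1 := by
    rw [ha, hb]
    push_cast
    field_simp
    ring
  have h := (Ulist_add_one_eq_length_of_dual a b ha0 hb0 ha2 hb2 hab).1
  rw [Vlist_eq_Ulist_add_length]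
  omega
end

section
/- Let n = (n_1,…,n_k) be an admissible tuple such that the Hirzebruch–Jung continued fraction [n_1,…,n_k]⁻ is defined and equals 0, and let p_j, q_j denote the convergents of (n_1,…,n_k). If n_i = 1 for some i with 1 < i < k, then the continued fraction [n_k, n_{k−1},…,n_{i+1}]⁻ of the reversed tail is defined and there exists an integer m ≥ 1 such that [n_k,…,n_{i+1}]⁻ = p_{i−1}/(m·p_{i−1} − q_{i−1}). -/
/-- The tuple `(a_i, a_{i+1}, …, a_j)` as a list of integers. -/
def seg (a : ℕ → ℤ) (i j : ℕ) : List ℤ :=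
  (List.range (j + 1 - i)).map fun t => a (i + t)

/-- The tuple `(a_i, a_{i+1}, …, a_j)` as a list of real numbers. -/
noncomputable def segR (a : ℕ → ℤ) (i j : ℕ) : List ℝ :=
  (seg a i j).map Int.cast

/-- Numerators of the convergents: `p_0 = 1`, `p_1 = a_1`,
`p_k = a_k p_{k−1} − p_{k−2}` for `k ≥ 2`. -/
def convP (a : ℕ → ℤ) : ℕ → ℤ
  | 0 => 1
  | 1 => a 1
  | k + 2 => a (k + 2) * convP a (k + 1) - convP a k

/-- Denominators of the convergents: `q_0 = 0`, `q_1 = 1`,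
`q_k = a_k q_{k−1} − q_{k−2}` for `k ≥ 2`. -/
def convQ (a : ℕ → ℤ) : ℕ → ℤ
  | 0 => 0
  | 1 => 1
  | k + 2 => a (k + 2) * convQ a (k + 1) - convQ a k

/-- The tridiagonal matrix `M(x)` (with real entries) with diagonal entries
`x_1, …, x_k` and all sub- and super-diagonal entries equal to `−1`. -/
noncomputable def MmatR (l : List ℤ) : Matrix (Fin l.length) (Fin l.length) ℝ :=
  Matrix.of fun i j =>
    if (i : ℕ) = (j : ℕ) then (l.get i : ℝ)
    else if (i : ℕ) + 1 = (j : ℕ) ∨ (j : ℕ) + 1 = (i : ℕ) then -1 else 0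

/-- A tuple of (non-negative) integers is admissible if `M(n)` is positive
semi-definite of rank at least `k − 1`. -/
def Admissible (l : List ℤ) : Prop :=
  (MmatR l).PosSemidef ∧ l.length - 1 ≤ (MmatR l).rank

lemma hj_cons {l : List ℝ} (hl : l ≠ []) (x : ℝ) : hj (x :: l) = x - 1 / hj l := by
  cases l with
  | nil => exact absurd rfl hl
  | cons y l => rfl

lemma hjDef_cons {l : List ℝ} (hl : l ≠ []) (x : ℝ) :
    hjDef (x :: l) ↔ hjDef l ∧ hj l ≠ 0 := by
  cases l with
  | nil => exact absurd rfl hl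
  | cons y l => rfl

lemma segR_ne_nil (a : ℕ → ℤ) {i j : ℕ} (h : i ≤ j) : segR a i j ≠ [] := by
  simp only [segR, seg, ne_eq, List.map_eq_nil_iff, List.range_eq_nil]
  omega

lemma segR_self (a : ℕ → ℤ) (i : ℕ) : segR a i i = [(a i : ℝ)] := by
  simp [segR, seg]

lemma segR_eq_cons (a : ℕ → ℤ) {i j : ℕ} (h : i ≤ j) :
    segR a i j = (a i : ℝ) :: segR a (i + 1) j := by
  obtain ⟨d, rfl⟩ := Nat.exists_eq_add_of_le h
  have e1 : i + d + 1 - i = d + 1 := by omega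
  have e2 : i + d + 1 - (i + 1) = d := by omega
  simp only [segR, seg, e1, e2, List.range_succ_eq_map, List.map_cons, List.map_map]
  simp [Function.comp_def, add_assoc, add_comm 1]

lemma reverse_segR_succ (a : ℕ → ℤ) {i j : ℕ} (h : i ≤ j + 1) :
    (segR a i (j + 1)).reverse = (a (j + 1) : ℝ) :: (segR a i j).reverse := by
  have e1 : j + 1 + 1 - i = (j + 1 - i) + 1 := by omega
  have e2 : i + (j + 1 - i) = j + 1 := by omega
  simp [segR, seg, e1, e2, List.range_succ]

lemma convP_mul_convQ_succ_sub (a : ℕ → ℤ) (j : ℕ) :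
    convP a j * convQ a (j + 1) - convP a (j + 1) * convQ a j = 1 := by
  induction j with
  | zero => simp [convP, convQ]
  | succ j ih =>
    simp only [convP, convQ]
    linear_combination ih

/-- If a continued fraction vanishes, so does the numerator of its last convergent. -/
lemma convP_eq_zero_of_hj_eq_zero (a : ℕ → ℤ) {k : ℕ} (hk : 1 ≤ k)
    (hdef : hjDef (segR a 1 k)) (hval : hj (segR a 1 k) = 0) : convP a k = 0 := by
  obtain rfl | hk := hk.eq_or_lt
  · simpa [segR_self, hj, convP] using hval
  have key : ∀ e, e + 2 ≤ k → hjDef (segR a (e + 2) k) ∧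
      hj (segR a (e + 2) k) * convP a (e + 1) = convP a e := by
    intro e
    induction e with
    | zero =>
      intro he
      rw [segR_eq_cons a (by omega), hjDef_cons (segR_ne_nil a he)] at hdef
      rw [segR_eq_cons a (by omega), hj_cons (segR_ne_nil a he)] at hval
      obtain ⟨h1, h2⟩ := hdef
      refine ⟨h1, ?_⟩
      simp only [convP, zero_add, Int.cast_one]
      simp only [Nat.reduceAdd] at hval h1 h2 ⊢
      field_simp at hval
      linarith
    | succ e ih =>
      intro he
      obtain ⟨h1, h2⟩ := ih (by omega)
      rw [segR_eq_cons a (by omega), hjDef_cons (segR_ne_nil a he)] at h1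
      rw [segR_eq_cons a (by omega), hj_cons (segR_ne_nil a he)] at h2
      obtain ⟨h1, h3⟩ := h1
      refine ⟨h1, ?_⟩
      simp only [convP, add_assoc, Nat.reduceAdd, Int.cast_sub, Int.cast_mul] at h1 h2 h3 ⊢
      field_simp at h2
      linarith
  obtain ⟨e, rfl⟩ : ∃ e, k = e + 2 := ⟨k - 2, by omega⟩
  have h := (key e le_rfl).2
  rw [segR_self] at h
  simp only [hj] at h
  simp only [convP]
  have h' : a (e + 2) * convP a (e + 1) = convP a e := by exact_mod_cast h
  linarith

/-- Positive semi-definiteness of `M(l)` in terms of its quadratic form, evaluated at the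
vector `(y_1, …, y_k)` padded by zeros. -/
lemma sum_nonneg_of_posSemidef_MmatR {l : List ℤ} (h : (MmatR l).PosSemidef) (y : ℕ → ℝ)
    (h0 : y 0 = 0) (hy : y (l.length + 1) = 0) :
    0 ≤ ∑ j : Fin l.length, y (j + 1) * (l.get j * y (j + 1) - y j - y (j + 2)) := by
  have hq := h.dotProduct_mulVec_nonneg (fun j : Fin l.length => y (j + 1))
  refine hq.trans_eq (Finset.sum_congr rfl fun j _ => ?_)
  simp only [star_trivial, Matrix.mulVec, dotProduct, Pi.star_apply]
  congr 1
  have hrow : ∀ b : Fin l.length, MmatR l j b * y (b + 1) =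
      (if j = b then (l.get j : ℝ) * y (j + 1) else 0)
        - (if (j : ℕ) + 1 = b then y (j + 2) else 0)
        - (if (b : ℕ) + 1 = j then y j else 0) := by
    intro b
    have e1 : (j : ℕ) + 1 = b → y (b + 1) = y (j + 2) := fun e => by rw [← e]
    have e2 : (b : ℕ) + 1 = j → y (b + 1) = y j := fun e => by rw [← e]
    simp only [MmatR, Matrix.of_apply, ← Fin.ext_iff]
    by_cases hjb : j = b
    · subst hjb
      simp
    · by_cases hu : (j : ℕ) + 1 = b
      · have hd : (b : ℕ) + 1 ≠ j := by omega
        simp [hjb, hu, hd, ← e1 hu]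
      · by_cases hd : (b : ℕ) + 1 = j
        · simp [hjb, hu, hd, ← e2 hd]
        · simp [hjb, hu, hd]
  have hup : ∑ b : Fin l.length, (if (j : ℕ) + 1 = b then y (j + 2) else 0) = y (j + 2) := by
    by_cases hj : (j : ℕ) + 1 < l.length
    · rw [Finset.sum_eq_single ⟨j + 1, hj⟩]
      · simp
      · intro b _ hb
        exact if_neg fun e => hb (Fin.ext e.symm)
      · simp
    · have : y (j + 2) = 0 := by
        have e : (j : ℕ) + 2 = l.length + 1 := by omega
        rw [e, hy]
      simp [this]
  have hdown : ∑ b : Fin l.length, (if (b : ℕ) + 1 = j then y j else 0) = y j := by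
    by_cases hj : (j : ℕ) = 0
    · simp [hj, h0]
    · rw [Finset.sum_eq_single ⟨j - 1, by omega⟩]
      · exact if_pos (by simp only; omega)
      · intro b _ hb
        exact if_neg fun e => hb (Fin.ext (by simp only; omega))
      · simp
  simp only [hrow, Finset.sum_sub_distrib, hup, hdown]
  simp
  ring

/-- If `M(a_1, …, a_k)` is positive semi-definite, then all convergents but the last one have
positive numerators. -/
lemma convP_pos_of_posSemidef (a : ℕ → ℤ) {k : ℕ} (ha : ∀ i, 1 ≤ i → i ≤ k → 0 ≤ a i)
    (h : (MmatR (seg a 1 k)).PosSemidef) {m : ℕ} (hm : m < k) : 0 < convP a m := by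
  have hlen : (seg a 1 k).length = k := by simp [seg]
  have hget : ∀ j : Fin (seg a 1 k).length, (seg a 1 k).get j = a (j + 1) := by
    intro j
    rw [List.get_eq_getElem]
    simp [seg, add_comm]
  induction m with
  | zero => simp [convP]
  | succ m ih =>
    have hP : (0 : ℝ) < convP a m := by exact_mod_cast ih (by omega)
    have ham : (0 : ℝ) ≤ a (m + 2) := by exact_mod_cast ha (m + 2) (by omega) (by omega)
    by_contra! hneg
    have hneg' : (convP a (m + 1) : ℝ) ≤ 0 := by exact_mod_cast hneg
    have hform : ∀ t : ℝ, 0 ≤ convP a m * (convP a (m + 1) - t)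
        + t * (a (m + 2) * t - convP a m) := by
      intro t
      let y : ℕ → ℝ := fun j =>
        if j = 0 then 0 else if j ≤ m + 1 then (convP a (j - 1) : ℝ) else if j = m + 2 then t else 0
      have hy := sum_nonneg_of_posSemidef_MmatR h y (by simp [y])
        (by rw [hlen]; simp only [y]; rw [if_neg (by omega), if_neg (by omega), if_neg (by omega)])
      simp only [hget] at hy
      rw [Fin.sum_univ_eq_sum_range
        (fun j => y (j + 1) * (a (j + 1) * y (j + 1) - y j - y (j + 2))), hlen,
        ← Finset.sum_subset (Finset.range_subset_range.2 (show m + 2 ≤ k by omega)),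
        Finset.sum_range_succ, Finset.sum_range_succ, Finset.sum_eq_zero, zero_add] at hy
      · have y1 : y (m + 1) = convP a m := by simp [y]
        have y2 : y (m + 2) = t := by simp [y]
        have y3 : y (m + 3) = 0 := by simp [y]
        have y4 : (a (m + 1) * convP a m - y m : ℝ) = convP a (m + 1) := by
          cases m with
          | zero => simp [y, convP]
          | succ m => simp [y, convP]
        simp only [add_assoc, Nat.reduceAdd, y1, y2, y3, y4] at hy
        linarith
      · intro j hj
        rw [Finset.mem_range] at hj
        have y1 : y (j + 1) = convP a j := by simp [y]; omega
        have y2 : y (j + 2) = convP a (j + 1) := by simp [y]; omega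
        have y4 : (a (j + 1) * convP a j - y j : ℝ) = convP a (j + 1) := by
          cases j with
          | zero => simp [y, convP]
          | succ j =>
            simp [y, convP, show j ≤ m by omega]
        rw [y1, y2, y4, sub_self, mul_zero]
      · intro j _ hj
        rw [Finset.mem_range] at hj
        have : y (j + 1) = 0 := by
          simp only [y]
          rw [if_neg (by omega), if_neg (by omega), if_neg (by omega)]
        rw [this, zero_mul]
    have ht := hform (convP a m / (a (m + 2) + 1))
    set P : ℝ := (convP a m : ℝ)
    set A : ℝ := (a (m + 2) : ℝ)
    set t : ℝ := P / (A + 1) with ht_def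
    have htpos : 0 < t := by positivity
    have hmul : t * (A + 1) = P := by rw [ht_def]; field_simp
    nlinarith [mul_pos htpos hP, mul_pos htpos htpos, mul_nonneg hP.le (neg_nonneg.2 hneg')]

/-- A reversed segment evaluates to a quotient of consecutive values of any positive solution of
the recurrence `u_{j+2} = a_{j+2} u_{j+1} − u_j` that starts with `u_i = 0`. -/
lemma hj_reverse_segR (a : ℕ → ℤ) (u : ℕ → ℤ) (i : ℕ) (h0 : u i = 0)
    (hrec : ∀ j, u (j + 2) = a (j + 2) * u (j + 1) - u j) (d : ℕ)
    (hpos : ∀ e ≤ d, 0 < u (i + 1 + e)) :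
    hjDef (segR a (i + 2) (i + 2 + d)).reverse ∧
      hj (segR a (i + 2) (i + 2 + d)).reverse = u (i + 2 + d) / u (i + 1 + d) := by
  induction d with
  | zero =>
    have h1 : (u (i + 1) : ℝ) ≠ 0 := by exact_mod_cast (hpos 0 le_rfl).ne'
    simp only [add_zero, segR_self, List.reverse_singleton, hjDef, hj, hrec, h0, true_and]
    push_cast
    field_simp
    ring
  | succ d ih =>
    obtain ⟨hd, hv⟩ := ih fun e he => hpos e (by omega)
    have h1 : (u (i + 1 + d) : ℝ) ≠ 0 := by exact_mod_cast (hpos d (by omega)).ne'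
    have h2 : (u (i + 2 + d) : ℝ) ≠ 0 := by
      have := hpos (d + 1) le_rfl
      rw [show i + 1 + (d + 1) = i + 2 + d by omega] at this
      exact_mod_cast this.ne'
    have hne : (segR a (i + 2) (i + 2 + d)).reverse ≠ [] := by
      simpa using segR_ne_nil a (Nat.le_add_right (i + 2) d)
    have hr := hrec (i + 1 + d)
    rw [show i + 1 + d + 2 = i + 2 + d + 1 by omega,
      show i + 1 + d + 1 = i + 2 + d by omega] at hr
    rw [← add_assoc, reverse_segR_succ a (by omega), hjDef_cons hne, hj_cons hne, hv, hr,
      show i + 1 + (d + 1) = i + 2 + d by omega]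
    refine ⟨⟨hd, div_ne_zero h2 h1⟩, ?_⟩
    push_cast
    field_simp

/-- Let `n = (n_1,…,n_k)` be an admissible tuple of non-negative integers with
`[n_1,…,n_k]⁻` defined and equal to `0`. If `n_i = 1` for some `1 < i < k`,
then the continued fraction `[n_k,…,n_{i+1}]⁻` of the reversed tail is defined
and equals `p_{i−1}/(m·p_{i−1} − q_{i−1})` for some integer `m ≥ 1`. -/
theorem stmt_18 (n : ℕ → ℤ) (k : ℕ) (hk : 1 ≤ k)
    (hnn : ∀ i, 1 ≤ i → i ≤ k → 0 ≤ n i) (hadm : Admissible (seg n 1 k))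
    (hdef : hjDef (segR n 1 k)) (hval : hj (segR n 1 k) = 0)
    (i : ℕ) (h1 : 1 < i) (h2 : i < k) (hni : n i = 1) :
    hjDef (segR n (i + 1) k).reverse ∧
      ∃ m : ℤ, 1 ≤ m ∧
        hj (segR n (i + 1) k).reverse =
          (convP n (i - 1) : ℝ) /
            ((m : ℝ) * (convP n (i - 1) : ℝ) - (convQ n (i - 1) : ℝ)) := by
  have hP : ∀ m < k, 0 < convP n m := fun m hm => convP_pos_of_posSemidef n hnn hadm.1 hm
  have hPk : convP n k = 0 := convP_eq_zero_of_hj_eq_zero n hk hdef hval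
  have hPnn : ∀ m ≤ k, 0 ≤ convP n m := fun m hm => by
    rcases hm.lt_or_eq with h | rfl
    · exact (hP m h).le
    · exact hPk.ge
  obtain ⟨i, rfl⟩ : ∃ i', i = i' + 1 := ⟨i - 1, by omega⟩
  obtain ⟨d, rfl⟩ : ∃ d, k = i + 2 + d := ⟨k - (i + 2), by omega⟩
  have hQ : ∀ m, m + 1 ≤ i + 2 + d → 0 < convQ n (m + 1) := by
    intro m
    induction m with
    | zero => simp [convQ]
    | succ m ih =>
      intro hm
      have hw := convP_mul_convQ_succ_sub n (m + 1)
      have := mul_nonneg (hPnn (m + 2) (by omega)) (ih (by omega)).le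
      exact pos_of_mul_pos_right (by linarith) (hP (m + 1) (by omega)).le
  let u : ℕ → ℤ := fun j => convP n i * convQ n j - convQ n i * convP n j
  have hrec : ∀ j, u (j + 2) = n (j + 2) * u (j + 1) - u j := by
    intro j
    simp only [u, convP, convQ]
    ring
  have hu : ∀ e, e ≤ d → 0 < u (i + 1 + e) := by
    intro e
    induction e with
    | zero =>
      intro _
      have hw := convP_mul_convQ_succ_sub n i
      simp only [u, add_zero]
      linarith
    | succ e ih =>
      intro he
      have hw := convP_mul_convQ_succ_sub n (i + 1 + e)
      have hstep : convP n (i + 1 + e) * u (i + 1 + e + 1) =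
          convP n (i + 1 + e + 1) * u (i + 1 + e) + convP n i := by
        simp only [u]
        linear_combination convP n i * hw
      have := mul_nonneg (hPnn (i + 1 + e + 1) (by omega)) (ih (by omega)).le
      have hi := hP i (by omega)
      exact pos_of_mul_pos_right (by rw [← add_assoc, hstep]; linarith)
        (hP (i + 1 + e) (by omega)).le
  obtain ⟨hd, hv⟩ := hj_reverse_segR n u i (by simp only [u]; ring) hrec d hu
  refine ⟨hd, convQ n (i + 1 + d), ?_, ?_⟩
  · have := hQ (i + d) (by omega)
    rw [show i + d + 1 = i + 1 + d by omega] at this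
    omega
  · have hw := convP_mul_convQ_succ_sub n (i + 1 + d)
    rw [show i + 1 + d + 1 = i + 2 + d by omega, hPk, zero_mul, sub_zero] at hw
    have hp : convP n (i + 1 + d) = 1 :=
      Int.eq_one_of_mul_eq_one_right (hPnn _ (by omega)) hw
    rw [hp, one_mul] at hw
    refine hv.trans ?_
    simp only [u, hPk, hp, hw, Nat.add_sub_cancel]
    push_cast
    ring_nf
end
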